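/- arXiv:2604.11062 — 4 statements merged into one kernel-verified Lean document; each statement's English description precedes it below -/
import Mathlib

section
/- Let U, M be positive integers, σ > 0, and for each u ∈ {1,…,U} let A_u be a complex M × N_u matrix. Let v : [0,1] → [0,1]^U be continuously differentiable with v(0) = (1,…,1) and v(1) = (0,…,0). Then Σ_{u=1}^U ∫_0^1 tr(A_u† (σ² I_M + Σ_{i=1}^U v_i(θ) A_i A_i†)^{-1} A_u) · (−v_u'(θ)) dθ = log det(I_M + σ^{-2} Σ_{u=1}^U A_u A_u†). -/
open Matrix

/-- The matrix `σ² I + ∑ᵤ vᵤ Aᵤ Aᵤᴴ` appearing in the MA-OAMP analysis. -/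
noncomputable def covMat {U M : ℕ} {N : Fin U → ℕ} (σ : ℝ)
    (A : ∀ u : Fin U, Matrix (Fin M) (Fin (N u)) ℂ) (v : Fin U → ℝ) :
    Matrix (Fin M) (Fin M) ℂ :=
  ((σ : ℂ) ^ 2) • (1 : Matrix (Fin M) (Fin M) ℂ) +
    ∑ i : Fin U, (v i : ℂ) • (A i * (A i)ᴴ)

open scoped ComplexOrder

/-- Jacobi's formula: the derivative of the determinant along a differentiable curve of matrices. -/
theorem hasDerivAt_det {n : Type*} [Fintype n] [DecidableEq n] {B : ℝ → Matrix n n ℂ}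
    {B' : Matrix n n ℂ} {t : ℝ} (h : ∀ i j, HasDerivAt (fun s => B s i j) (B' i j) t) :
    HasDerivAt (fun s => (B s).det) (((B t).adjugate * B').trace) t := by
  simp only [Matrix.det_apply']
  have key : ((B t).adjugate * B').trace = ∑ p : Equiv.Perm n,
      ((Equiv.Perm.sign p : ℤ) : ℂ) *
        ∑ i, (∏ j ∈ Finset.univ.erase i, B t (p j) j) • B' (p i) i := by
    have hcol : ∀ i, ((B t).adjugate * B') i i =
        ((B t).updateCol i (fun k => B' k i)).det := fun i => by
      rw [← Matrix.cramer_apply, Matrix.cramer_eq_adjugate_mulVec]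
      rfl
    simp only [Matrix.trace, Matrix.diag, hcol, Matrix.det_apply', Finset.mul_sum]
    rw [Finset.sum_comm]
    refine Finset.sum_congr rfl fun p _ => Finset.sum_congr rfl fun i _ => ?_
    rw [← Finset.prod_erase_mul _ _ (Finset.mem_univ i), Matrix.updateCol_self, smul_eq_mul]
    congr 2
    exact Finset.prod_congr rfl fun j hj => Matrix.updateCol_ne (Finset.ne_of_mem_erase hj)
  rw [key]
  exact HasDerivAt.fun_sum fun p _ =>
    (HasDerivAt.fun_finsetProd fun i _ => h (p i) i).const_mul _

/-- Logarithmic form of Jacobi's formula at a matrix whose determinant is a positive real. -/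
theorem hasDerivAt_log_re_det {n : Type*} [Fintype n] [DecidableEq n] {B : ℝ → Matrix n n ℂ}
    {B' : Matrix n n ℂ} {t : ℝ} (h : ∀ i j, HasDerivAt (fun s => B s i j) (B' i j) t)
    (hpos : (B t).PosDef) :
    HasDerivAt (fun s => Real.log (B s).det.re) (((B t)⁻¹ * B').trace.re) t := by
  obtain ⟨hre, him⟩ := Complex.pos_iff.1 hpos.det_pos
  have hdet : (B t).det = ((B t).det.re : ℂ) := Complex.ext rfl him.symm
  have hd : HasDerivAt (fun s => (B s).det.re) (((B t).adjugate * B').trace.re) t :=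
    Complex.reCLM.hasFDerivAt.comp_hasDerivAt t (hasDerivAt_det h)
  convert hd.log hre.ne' using 1
  rw [Matrix.inv_def, Ring.inverse_eq_inv', Matrix.smul_mul, Matrix.trace_smul, hdet,
    ← Complex.ofReal_inv, smul_eq_mul, Complex.re_ofReal_mul, Complex.ofReal_re]
  ring

theorem covMat_posDef {U M : ℕ} {N : Fin U → ℕ} {σ : ℝ} (hσ : 0 < σ)
    (A : ∀ u : Fin U, Matrix (Fin M) (Fin (N u)) ℂ) {w : Fin U → ℝ} (hw : ∀ i, 0 ≤ w i) :
    (covMat σ A w).PosDef := by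
  refine Matrix.PosDef.add_posSemidef (Matrix.PosDef.one.smul ?_)
    (Matrix.posSemidef_sum _ fun i _ =>
      (Matrix.posSemidef_self_mul_conjTranspose (A i)).smul ?_)
  · exact_mod_cast pow_pos hσ 2
  · exact_mod_cast hw i

theorem hasDerivAt_covMat_apply {U M : ℕ} {N : Fin U → ℕ} (σ : ℝ)
    (A : ∀ u : Fin U, Matrix (Fin M) (Fin (N u)) ℂ) {v : ℝ → Fin U → ℝ} {v' : Fin U → ℝ} {t : ℝ}
    (hv : ∀ u, HasDerivAt (fun s => v s u) (v' u) t) (i j : Fin M) :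
    HasDerivAt (fun s => covMat σ A (v s) i j)
      ((∑ u, (v' u : ℂ) • (A u * (A u)ᴴ)) i j) t := by
  simp only [covMat, Matrix.add_apply, Matrix.sum_apply, Matrix.smul_apply, smul_eq_mul]
  exact (HasDerivAt.fun_sum fun u _ => (hv u).ofReal_comp.mul_const _).const_add _

theorem continuous_covMat {U M : ℕ} {N : Fin U → ℕ} (σ : ℝ)
    (A : ∀ u : Fin U, Matrix (Fin M) (Fin (N u)) ℂ) {v : ℝ → Fin U → ℝ} (hv : Continuous v) :
    Continuous fun t => covMat σ A (v t) := by
  unfold covMat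
  fun_prop

theorem Matrix.continuousOn_inv {X n : Type*} [TopologicalSpace X] [Fintype n] [DecidableEq n]
    {B : X → Matrix n n ℂ} {s : Set X} (hB : Continuous B) (hdet : ∀ x ∈ s, (B x).det ≠ 0) :
    ContinuousOn (fun x => (B x)⁻¹) s := by
  simp only [Matrix.inv_def, Ring.inverse_eq_inv']
  exact (hB.matrix_det.continuousOn.inv₀ hdet).smul hB.matrix_adjugate.continuousOn

theorem log_re_det_covMat {U M : ℕ} {N : Fin U → ℕ} {σ : ℝ} (hσ : 0 < σ)
    (A : ∀ u : Fin U, Matrix (Fin M) (Fin (N u)) ℂ) :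
    Real.log (covMat σ A fun _ => 1).det.re - Real.log (covMat σ A fun _ => 0).det.re =
      Real.log (((1 : Matrix (Fin M) (Fin M) ℂ)
          + (((σ : ℂ) ^ 2)⁻¹) • ∑ u : Fin U, A u * (A u)ᴴ).det.re) := by
  have hσ' : ((σ : ℂ) ^ 2) ≠ 0 := by exact_mod_cast (pow_pos hσ 2).ne'
  have hone : covMat σ A (fun _ => 1) = ((σ : ℂ) ^ 2) • ((1 : Matrix (Fin M) (Fin M) ℂ)
      + (((σ : ℂ) ^ 2)⁻¹) • ∑ u : Fin U, A u * (A u)ᴴ) := by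
    simp [covMat, smul_smul, hσ']
  have hpow : ((σ : ℂ) ^ 2) ^ M = (((σ ^ 2) ^ M : ℝ) : ℂ) := by push_cast; rfl
  have hpos := (Complex.pos_iff.1
    (covMat_posDef hσ A (w := fun _ => 1) fun _ => zero_le_one).det_pos).1
  have hzero : (covMat σ A fun _ => 0).det.re = (σ ^ 2) ^ M := by
    simp only [covMat, Complex.ofReal_zero, zero_smul, Finset.sum_const_zero, add_zero,
      Matrix.det_smul, Matrix.det_one, mul_one, Fintype.card_fin, hpow, Complex.ofReal_re]
  rw [hone, Matrix.det_smul, Fintype.card_fin, hpow, Complex.re_ofReal_mul] at hpos ⊢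
  rw [hzero, Real.log_mul (by positivity) (pos_of_mul_pos_right hpos (by positivity)).ne']
  ring

/-- path independence of the sum of the users' path integrals.
For any continuously differentiable variance path `v : [0,1] → [0,1]^U` from the
all-ones vector to zero,
`∑ᵤ ∫₀¹ tr(Aᵤᴴ (σ²I + ∑ᵢ vᵢ(θ) Aᵢ Aᵢᴴ)⁻¹ Aᵤ)·(−vᵤ'(θ)) dθ
  = log det(I + σ⁻² ∑ᵤ Aᵤ Aᵤᴴ)`. -/
theorem sum_path_integral_eq_sum_capacity {U M : ℕ} (hU : 0 < U) (hM : 0 < M)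
    {N : Fin U → ℕ} (σ : ℝ) (hσ : 0 < σ)
    (A : ∀ u : Fin U, Matrix (Fin M) (Fin (N u)) ℂ)
    (v : ℝ → Fin U → ℝ) (hv : ContDiff ℝ 1 v)
    (hrange : ∀ θ ∈ Set.Icc (0:ℝ) 1, ∀ i, v θ i ∈ Set.Icc (0:ℝ) 1)
    (h0 : v 0 = fun _ => 1) (h1 : v 1 = fun _ => 0) :
    ∑ u : Fin U, ∫ θ in (0:ℝ)..1,
        ((((A u)ᴴ * (covMat σ A (v θ))⁻¹ * A u).trace).re)
          * (-(deriv (fun t => v t u) θ))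
      = Real.log (((1 : Matrix (Fin M) (Fin M) ℂ)
          + (((σ : ℂ) ^ 2)⁻¹) • ∑ u : Fin U, A u * (A u)ᴴ).det.re) := by
  have hvi : ∀ u, ContDiff ℝ 1 fun t => v t u := contDiff_pi.1 hv
  have hpos : ∀ θ ∈ Set.uIcc (0 : ℝ) 1, (covMat σ A (v θ)).PosDef := fun θ hθ =>
    covMat_posDef hσ A fun i => (hrange θ (by rwa [Set.uIcc_of_le zero_le_one] at hθ) i).1
  have hinv : ContinuousOn (fun θ => (covMat σ A (v θ))⁻¹) (Set.uIcc 0 1) :=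
    Matrix.continuousOn_inv (continuous_covMat σ A hv.continuous) fun θ hθ =>
      (hpos θ hθ).det_pos.ne'
  have hint : ∀ u, IntervalIntegrable (fun θ =>
      ((((A u)ᴴ * (covMat σ A (v θ))⁻¹ * A u).trace).re) * (-(deriv (fun t => v t u) θ)))
      MeasureTheory.volume 0 1 := fun u => by
    have hlin : Continuous fun C : Matrix (Fin M) (Fin M) ℂ => (((A u)ᴴ * C * A u).trace).re := by
      fun_prop
    exact ((hlin.comp_continuousOn hinv).mul
      ((hvi u).continuous_deriv le_rfl).neg.continuousOn).intervalIntegrable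
  have hderiv : ∀ θ ∈ Set.uIcc (0 : ℝ) 1,
      HasDerivAt (fun t => -Real.log (covMat σ A (v t)).det.re)
        (∑ u, ((((A u)ᴴ * (covMat σ A (v θ))⁻¹ * A u).trace).re)
          * (-(deriv (fun t => v t u) θ))) θ := fun θ hθ => by
    have hd := (hasDerivAt_log_re_det (hasDerivAt_covMat_apply σ A fun u =>
      ((hvi u).differentiable one_ne_zero θ).hasDerivAt) (hpos θ hθ)).fun_neg
    refine hd.congr_deriv ?_
    rw [Finset.mul_sum, Matrix.trace_sum, Complex.re_sum, ← Finset.sum_neg_distrib]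
    refine Finset.sum_congr rfl fun u _ => ?_
    rw [Matrix.mul_smul, Matrix.trace_smul, smul_eq_mul, Complex.re_ofReal_mul,
      ← Matrix.mul_assoc, Matrix.trace_mul_comm (_ * A u), ← Matrix.mul_assoc]
    ring
  rw [← intervalIntegral.integral_finsetSum fun u _ => hint u,
    intervalIntegral.integral_eq_sub_of_hasDerivAt hderiv
      (by simpa only [Finset.sum_fn] using IntervalIntegrable.sum Finset.univ fun u _ => hint u),
    h0, h1, ← log_re_det_covMat hσ A]
  ring
end

section
/- Let P_1, …, P_U be Hermitian positive semidefinite complex M × M matrices and let (k_1, …, k_U) be a permutation of {1,…,U}. Define the vertex rates r_{k_i} = log det(I_M + Σ_{j=1}^{i} P_{k_j}) − log det(I_M + Σ_{j=1}^{i−1} P_{k_j}) for i = 1,…,U. Then (a) Σ_{i=1}^U r_{k_i} = log det(I_M + Σ_{u=1}^U P_u), and (b) for every subset S ⊆ {1,…,U}, Σ_{u∈S} r_u ≤ log det(I_M + Σ_{u∈S} P_u). -/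
open Matrix ComplexOrder

/-- `f(S) = log det(I + ∑_{u ∈ S} Pᵤ)` for Hermitian PSD matrices `Pᵤ`
(the determinant is a positive real, taken via its real part). -/
noncomputable def logdetSet {U M : ℕ} (P : Fin U → Matrix (Fin M) (Fin M) ℂ)
    (S : Finset (Fin U)) : ℝ :=
  Real.log (((1 : Matrix (Fin M) (Fin M) ℂ) + ∑ u ∈ S, P u).det.re)

open scoped MatrixOrder

namespace Matrix

variable {n : Type*} [Fintype n] [DecidableEq n]

lemma PosSemidef.exists_eq_conjTranspose_mul_self {A : Matrix n n ℂ} (hA : A.PosSemidef) :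
    ∃ R : Matrix n n ℂ, A = Rᴴ * R :=
  CStarAlgebra.nonneg_iff_eq_star_mul_self.mp hA.nonneg

lemma PosSemidef.one_le_det_one_add {A : Matrix n n ℂ} (hA : A.PosSemidef) :
    1 ≤ (1 + A).det := by
  have h : (1 + A).det = ∏ i, (1 + (hA.1.eigenvalues i : ℂ)) := by
    conv_lhs => rw [hA.1.spectral_theorem, Unitary.conjStarAlgAut_apply, mul_assoc,
      det_one_add_mul_comm, mul_assoc, Unitary.coe_star_mul_self, mul_one, ← diagonal_one,
      diagonal_add, det_diagonal]
    simp
  rw [h]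
  refine Finset.prod_induction _ (1 ≤ ·) (fun _ _ => one_le_mul_of_one_le_of_one_le) le_rfl
    fun i _ => ?_
  exact le_add_of_nonneg_right (by exact_mod_cast hA.eigenvalues_nonneg i)

/-- Factoring out `A`, the matrix determinant lemma for a positive definite `A`. -/
lemma PosDef.det_add_conjTranspose_mul_self {A : Matrix n n ℂ} (hA : A.PosDef)
    (R : Matrix n n ℂ) : (A + Rᴴ * R).det = A.det * (1 + R * A⁻¹ * Rᴴ).det := by
  have hu : IsUnit A.det := (isUnit_iff_isUnit_det A).mp hA.isUnit
  rw [mul_assoc R, det_one_add_mul_comm, ← det_mul, mul_add, mul_one, mul_assoc A⁻¹,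
    mul_nonsing_inv_cancel_left _ _ hu]

lemma PosDef.det_le_det_add {A Q : Matrix n n ℂ} (hA : A.PosDef) (hQ : Q.PosSemidef) :
    A.det ≤ (A + Q).det := by
  obtain ⟨R, rfl⟩ := hQ.exists_eq_conjTranspose_mul_self
  rw [hA.det_add_conjTranspose_mul_self]
  exact le_mul_of_one_le_right hA.det_pos.le
    (hA.inv.posSemidef.mul_mul_conjTranspose_same R).one_le_det_one_add

lemma PosDef.inv_sub_inv_add_posSemidef {A C : Matrix n n ℂ} (hA : A.PosDef)
    (hC : C.PosSemidef) : (A⁻¹ - (A + C)⁻¹).PosSemidef := by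
  have hB : (A + C).PosDef := hA.add_posSemidef hC
  have : Invertible (A + C) := hB.isUnit.invertible
  have : Invertible A⁻¹ := hA.inv.isUnit.invertible
  have h := PosDef.fromBlocks₁₁ (1 : Matrix n n ℂ) A⁻¹ hB
  rw [PosDef.fromBlocks₂₂ (A + C) 1 hA.inv] at h
  simpa [nonsing_inv_nonsing_inv _ ((isUnit_iff_isUnit_det A).mp hA.isUnit), hC] using h

lemma PosDef.det_add_add_mul_det_le {A C Q : Matrix n n ℂ} (hA : A.PosDef)
    (hC : C.PosSemidef) (hQ : Q.PosSemidef) :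
    (A + C + Q).det * A.det ≤ (A + C).det * (A + Q).det := by
  have hB : (A + C).PosDef := hA.add_posSemidef hC
  obtain ⟨R, rfl⟩ := hQ.exists_eq_conjTranspose_mul_self
  rw [hB.det_add_conjTranspose_mul_self, hA.det_add_conjTranspose_mul_self, mul_assoc,
    mul_comm _ A.det]
  refine mul_le_mul_of_nonneg_left (mul_le_mul_of_nonneg_left ?_ hA.det_pos.le) hB.det_pos.le
  have h := (PosDef.one.add_posSemidef
    (hB.inv.posSemidef.mul_mul_conjTranspose_same R)).det_le_det_add
    ((hA.inv_sub_inv_add_posSemidef hC).mul_mul_conjTranspose_same R)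
  rwa [add_assoc, ← add_mul, ← mul_add, add_sub_cancel] at h

end Matrix

lemma logdetSet_empty {U M : ℕ} (P : Fin U → Matrix (Fin M) (Fin M) ℂ) :
    logdetSet P ∅ = 0 := by
  simp [logdetSet]

/-- Adding a user to a larger set of users increases the log-determinant by less. -/
lemma logdetSet_insert_sub_le {U M : ℕ} {P : Fin U → Matrix (Fin M) (Fin M) ℂ}
    (hP : ∀ u, (P u).PosSemidef) {S T : Finset (Fin U)} (hST : S ⊆ T) {a : Fin U} (ha : a ∉ T) :
    logdetSet P (insert a T) - logdetSet P T ≤ logdetSet P (insert a S) - logdetSet P S := by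
  have hpd (V : Finset (Fin U)) : (1 + ∑ u ∈ V, P u).PosDef :=
    PosDef.one.add_posSemidef (posSemidef_sum _ fun u _ => hP u)
  have hpos (V : Finset (Fin U)) := Complex.pos_iff.mp (hpd V).det_pos
  have key := (hpd S).det_add_add_mul_det_le (posSemidef_sum (T \ S) fun u _ => hP u) (hP a)
  have hT : 1 + ∑ u ∈ S, P u + ∑ u ∈ T \ S, P u = 1 + ∑ u ∈ T, P u := by
    rw [add_assoc, add_comm (∑ u ∈ S, P u), Finset.sum_sdiff hST]
  have hins {V : Finset (Fin U)} (hV : a ∉ V) :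
      1 + ∑ u ∈ V, P u + P a = 1 + ∑ u ∈ insert a V, P u := by
    rw [Finset.sum_insert hV, add_comm (P a), add_assoc]
  rw [hT, hins ha, hins fun h => ha (hST h)] at key
  have hre := (Complex.le_def.mp key).1
  simp only [Complex.mul_re, ← (hpos _).2, mul_zero, sub_zero] at hre
  have hlog := Real.log_le_log (mul_pos (hpos _).1 (hpos _).1) hre
  rw [Real.log_mul (hpos _).1.ne' (hpos _).1.ne', Real.log_mul (hpos _).1.ne' (hpos _).1.ne']
    at hlog
  unfold logdetSet
  linarith

/-- successive log-det increments along any permutation give a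
vertex of the dominant face: (a) they sum to the sum capacity
`log det(I + ∑ᵤ Pᵤ)`, and (b) they satisfy all subset rate constraints
`∑_{u∈S} rᵤ ≤ log det(I + ∑_{u∈S} Pᵤ)`. -/
theorem vertex_rates_sum_and_subset_constraints {U M : ℕ}
    (P : Fin U → Matrix (Fin M) (Fin M) ℂ) (hP : ∀ u, (P u).PosSemidef)
    (k : Equiv.Perm (Fin U)) (r : Fin U → ℝ)
    (hr : ∀ i : Fin U,
      r (k i) = logdetSet P ((Finset.Iic i).image k)
        - logdetSet P ((Finset.Iio i).image k)) :
    (∑ u, r u = logdetSet P Finset.univ) ∧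
      ∀ S : Finset (Fin U), ∑ u ∈ S, r u ≤ logdetSet P S := by
  have hIic (i : Fin U) : (Finset.Iic i).image k = insert (k i) ((Finset.Iio i).image k) := by
    rw [← Finset.image_insert, Finset.Iio_insert]
  have hk {i : Fin U} {T : Finset (Fin U)} (hi : i ∉ T) : k i ∉ T.image k := by
    simpa using hi
  constructor
  · suffices h : ∀ T : Finset (Fin U), IsLowerSet (T : Set (Fin U)) →
        ∑ u ∈ T.image k, r u = logdetSet P (T.image k) by
      simpa [Finset.image_univ_of_surjective k.surjective] using
        h Finset.univ (by simpa using isLowerSet_univ)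
    intro T
    induction T using Finset.induction_on_max with
    | empty => simp [logdetSet_empty]
    | insert a T hT ih =>
      intro hlow
      have haT : T = Finset.Iio a := by
        ext x
        rw [Finset.mem_Iio]
        refine ⟨hT x, fun hx => ?_⟩
        have hmem : x ∈ insert a T := hlow hx.le (Finset.mem_insert_self a T)
        exact (Finset.mem_insert.mp hmem).resolve_left hx.ne
      have ih' := ih (by rw [haT, Finset.coe_Iio]; exact isLowerSet_Iio a)
      rw [Finset.image_insert, Finset.sum_insert (hk fun h => (hT a h).false), ih', hr, hIic,
        ← haT, sub_add_cancel]
  · suffices h : ∀ T : Finset (Fin U), ∑ u ∈ T.image k, r u ≤ logdetSet P (T.image k) by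
      intro S
      simpa [Finset.image_image] using h (S.image k.symm)
    intro T
    induction T using Finset.induction_on_max with
    | empty => simp [logdetSet_empty]
    | insert a T hT ih =>
      have hsub : T.image k ⊆ (Finset.Iio a).image k :=
        Finset.image_subset_image fun x hx => Finset.mem_Iio.mpr (hT x hx)
      have hle := logdetSet_insert_sub_le hP hsub (hk (by simp : a ∉ Finset.Iio a))
      rw [Finset.image_insert, Finset.sum_insert (hk fun h => (hT a h).false), hr, hIic]
      linarith
end

section
/- Let U, M be positive integers, σ > 0, v_1, …, v_U > 0, and for each u let A_u be a complex M × N_u matrix with N_u ≥ 1. Set Σ = (σ² I_M + Σ_{i=1}^U v_i A_i A_i†)^{-1}. Then: (a) tr(A_u† Σ A_u) is a nonnegative real number, strictly positive whenever A_u ≠ 0; and (b) v_u · tr(A_u† Σ A_u) < N_u. Consequently, whenever A_u ≠ 0, the MA-OAMP parameter τ_u = N_u / tr(A_u† Σ A_u) − v_u is strictly positive. -/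
open Matrix

open scoped ComplexOrder

/-- A nonzero congruence of a positive definite matrix has positive trace. -/
theorem Matrix.PosDef.trace_conjTranspose_mul_mul_pos {m n : Type*} [Fintype m] [Fintype n]
    {P : Matrix m m ℂ} (hP : P.PosDef) {X : Matrix m n ℂ} (hX : X ≠ 0) :
    0 < (Xᴴ * P * X).trace := by
  have key (j : n) : (Xᴴ * P * X) j j = star (X.col j) ⬝ᵥ (P *ᵥ X.col j) := by
    rw [Matrix.mul_assoc]
    rfl
  obtain ⟨i, j, hij⟩ : ∃ i j, X i j ≠ 0 := by
    by_contra! h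
    exact hX (Matrix.ext h)
  refine Finset.sum_pos' (fun k _ => ?_) ⟨j, Finset.mem_univ j, ?_⟩
  · rw [Matrix.diag_apply, key]
    exact hP.posSemidef.dotProduct_mulVec_nonneg _
  · rw [Matrix.diag_apply, key]
    exact hP.dotProduct_mulVec_pos fun h => hij (congrFun h i)

/-- If `S = v B Bᴴ + P` with `P` and `S` positive definite and `v > 0`, then
`v tr(Bᴴ S⁻¹ B)` is less than the number of columns of `B`. -/
theorem Matrix.PosDef.mul_trace_conjTranspose_inv_mul_lt {m n : Type*} [Fintype m]
    [DecidableEq m] [Fintype n] [Nonempty n] {S P : Matrix m m ℂ} (hS : S.PosDef)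
    (hP : P.PosDef) {v : ℝ} (hv : 0 < v) (B : Matrix m n ℂ)
    (hSP : S = (v : ℂ) • (B * Bᴴ) + P) :
    v * ((Bᴴ * S⁻¹ * B).trace).re < Fintype.card n := by
  classical
  rcases eq_or_ne B 0 with rfl | hB
  · simp [Fintype.card_pos]
  have hdet : IsUnit S.det := (Matrix.isUnit_iff_isUnit_det S).1 hS.isUnit
  set X := S⁻¹ * B
  set G := Bᴴ * S⁻¹ * B
  have hSX : S * X = B := Matrix.mul_nonsing_inv_cancel_left S B hdet
  have hX : X ≠ 0 := by
    intro h
    rw [h, Matrix.mul_zero] at hSX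
    exact hB hSX.symm
  have hG : Gᴴ = G := isHermitian_conjTranspose_mul_mul B hS.inv.1
  have hGX : G = Bᴴ * X := Matrix.mul_assoc _ _ _
  have hXB : Xᴴ * B = G := by
    change (S⁻¹ * B)ᴴ * B = Bᴴ * S⁻¹ * B
    rw [Matrix.conjTranspose_mul, hS.inv.1.eq]
  have hGG : G = (v : ℂ) • (G * G) + Xᴴ * P * X := by
    calc G = Xᴴ * (S * X) := by rw [hSX, hXB]
      _ = (v : ℂ) • ((Xᴴ * B) * (Bᴴ * X)) + Xᴴ * P * X := by
        rw [hSP]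
        simp only [Matrix.add_mul, Matrix.mul_add, Matrix.smul_mul, Matrix.mul_smul,
          Matrix.mul_assoc]
      _ = _ := by rw [hXB, ← hGX]
  have htr : G.trace.re = v * (G * G).trace.re + (Xᴴ * P * X).trace.re := by
    have h := congrArg (fun Y : Matrix n n ℂ => Y.trace.re) hGG
    simpa [Matrix.trace_add, Matrix.trace_smul] using h
  have hpos := (Complex.pos_iff.1 (hP.trace_conjTranspose_mul_mul_pos hX)).1
  have hsq : 0 ≤ ((1 - (v : ℂ) • G)ᴴ * (1 - (v : ℂ) • G)).trace.re :=
    (Complex.nonneg_iff.1 (Matrix.posSemidef_conjTranspose_mul_self _).trace_nonneg).1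
  have hexp : ((1 - (v : ℂ) • G)ᴴ * (1 - (v : ℂ) • G)).trace.re =
      Fintype.card n - 2 * (v * G.trace.re) + v * (v * (G * G).trace.re) := by
    simp [Matrix.conjTranspose_sub, Matrix.conjTranspose_smul, hG, Matrix.sub_mul,
      Matrix.mul_sub, Matrix.trace_sub, Matrix.trace_smul]
    ring
  rw [hexp] at hsq
  nlinarith [mul_pos hv hpos]

/-- A positive multiple of the identity plus a sum of positive multiples of Gram matrices is
positive definite. -/
theorem posDef_smul_one_add_sum {U M : ℕ} {N : Fin U → ℕ} {σ : ℝ} (hσ : 0 < σ)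
    {v : Fin U → ℝ} (hv : ∀ i, 0 < v i)
    (A : ∀ u : Fin U, Matrix (Fin M) (Fin (N u)) ℂ) (s : Finset (Fin U)) :
    (((σ : ℂ) ^ 2) • (1 : Matrix (Fin M) (Fin M) ℂ) +
      ∑ i ∈ s, (v i : ℂ) • (A i * (A i)ᴴ)).PosDef := by
  have hσ' : (0 : ℂ) < (σ : ℂ) ^ 2 := by exact_mod_cast pow_pos hσ 2
  refine (Matrix.PosDef.one.smul hσ').add_posSemidef (Matrix.posSemidef_sum s fun i _ => ?_)
  exact (Matrix.posSemidef_self_mul_conjTranspose (A i)).smul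
    (Complex.zero_le_real.2 (hv i).le)

/-- with `Σ = (σ²I + ∑ᵢ vᵢ Aᵢ Aᵢᴴ)⁻¹`, the trace `tr(Aᵤᴴ Σ Aᵤ)` is
a nonnegative real number, strictly positive when `Aᵤ ≠ 0`; moreover
`vᵤ · tr(Aᵤᴴ Σ Aᵤ) < Nᵤ`, hence the MA-OAMP parameter
`τᵤ = Nᵤ / tr(Aᵤᴴ Σ Aᵤ) − vᵤ` is strictly positive when `Aᵤ ≠ 0`. -/
theorem trace_bounds_and_tau_pos {U M : ℕ} (hU : 0 < U) (hM : 0 < M)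
    {N : Fin U → ℕ} (hN : ∀ u, 1 ≤ N u) (σ : ℝ) (hσ : 0 < σ)
    (v : Fin U → ℝ) (hv : ∀ i, 0 < v i)
    (A : ∀ u : Fin U, Matrix (Fin M) (Fin (N u)) ℂ) (u : Fin U) :
    (((A u)ᴴ * (covMat σ A v)⁻¹ * A u).trace).im = 0 ∧
    0 ≤ (((A u)ᴴ * (covMat σ A v)⁻¹ * A u).trace).re ∧
    (A u ≠ 0 → 0 < (((A u)ᴴ * (covMat σ A v)⁻¹ * A u).trace).re) ∧
    v u * (((A u)ᴴ * (covMat σ A v)⁻¹ * A u).trace).re < (N u : ℝ) ∧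
    (A u ≠ 0 →
      0 < (N u : ℝ) / (((A u)ᴴ * (covMat σ A v)⁻¹ * A u).trace).re - v u) := by
  have hS : (covMat σ A v).PosDef := posDef_smul_one_add_sum hσ hv A Finset.univ
  have hnonneg := Complex.nonneg_iff.1
    (hS.inv.posSemidef.conjTranspose_mul_mul_same (A u)).trace_nonneg
  have hpos (h : A u ≠ 0) :=
    (Complex.pos_iff.1 (hS.inv.trace_conjTranspose_mul_mul_pos h)).1
  have : Nonempty (Fin (N u)) := ⟨⟨0, hN u⟩⟩
  have hlt : v u * (((A u)ᴴ * (covMat σ A v)⁻¹ * A u).trace).re < (N u : ℝ) := by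
    have h := hS.mul_trace_conjTranspose_inv_mul_lt
      (posDef_smul_one_add_sum hσ hv A (Finset.univ.erase u)) (hv u) (A u) (by
        rw [covMat, ← Finset.add_sum_erase _ _ (Finset.mem_univ u)]
        exact add_left_comm _ _ _)
    simpa using h
  refine ⟨hnonneg.2.symm, hnonneg.1, hpos, hlt, fun h => ?_⟩
  rw [sub_pos, lt_div_iff₀ (hpos h)]
  exact hlt
end

section
/- For an integer B ≥ 2 and reals p, ρ > 0, let J be uniform on {0,…,B−1}, let z_0,…,z_{B−1} be i.i.d. real standard Gaussians independent of J, and set y_b = √(ρp)·1{b = J} + z_b. Define the section MMSE as mmse(B, ρ, p) = Σ_{b=0}^{B−1} E[(√p·1{b = J} − E[√p·1{b = J} | σ(y_0,…,y_{B−1})])²]. Then for any sequences B_n → ∞, ρ_n > 0, p_n > 0 with liminf_n ρ_n p_n / (2 log B_n) > 1, one has mmse(B_n, ρ_n, p_n)/p_n → 0. -/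
open MeasureTheory ProbabilityTheory

/-- Canonical probability space for one position-modulated section: a uniform
position `J ∈ {0,…,B−1}` together with `B` i.i.d. standard Gaussian noises. -/
noncomputable def secMeasure (B : ℕ) : Measure (Fin B × (Fin B → ℝ)) :=
  ((B : ENNReal)⁻¹ • Measure.count).prod
    (Measure.pi fun _ : Fin B => gaussianReal 0 1)

/-- The section signal: `√p` at the nonzero position `J = ω.1`, `0` elsewhere. -/
noncomputable def secSignal (B : ℕ) (p : ℝ) (b : Fin B)
    (ω : Fin B × (Fin B → ℝ)) : ℝ :=
  Real.sqrt p * (if ω.1 = b then 1 else 0)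

/-- The observations `y_b = √(ρp)·1{b = J} + z_b`. -/
noncomputable def secObs (B : ℕ) (ρ p : ℝ) (ω : Fin B × (Fin B → ℝ)) :
    Fin B → ℝ :=
  fun b => Real.sqrt (ρ * p) * (if ω.1 = b then 1 else 0) + ω.2 b

/-- The section MMSE
`mmse(B,ρ,p) = ∑_b E[(√p·1{b=J} − E[√p·1{b=J} | σ(y)])²]`. -/
noncomputable def secMMSE (B : ℕ) (ρ p : ℝ) : ℝ :=
  ∑ b : Fin B, ∫ ω,
    (secSignal B p b ω -
      ((secMeasure B)[secSignal B p b |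
        MeasurableSpace.comap (secObs B ρ p) inferInstance]) ω) ^ 2
    ∂(secMeasure B)

/-- The conditional expectation minimizes the mean squared error among all square-integrable
`m`-measurable estimators. -/
lemma integral_sq_sub_condExp_le {Ω : Type*} {m m₀ : MeasurableSpace Ω} {μ : Measure Ω}
    [IsFiniteMeasure μ] (hm : m ≤ m₀) {f g : Ω → ℝ} (hf : MemLp f 2 μ) (hg : MemLp g 2 μ)
    (hgm : StronglyMeasurable[m] g) :
    ∫ ω, (f ω - (μ[f | m]) ω) ^ 2 ∂μ ≤ ∫ ω, (f ω - g ω) ^ 2 ∂μ := by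
  have hfg : MemLp (f - g) 2 μ := hf.sub hg
  have hcond : μ[f - g | m] =ᵐ[μ] μ[f | m] - g := by
    have h := condExp_sub (m := m) (hf.integrable one_le_two) (hg.integrable one_le_two)
    rwa [condExp_of_stronglyMeasurable hm hgm (hg.integrable one_le_two)] at h
  calc ∫ ω, (f ω - (μ[f | m]) ω) ^ 2 ∂μ
      = ∫ ω, ((f - g) ω - (μ[f - g | m]) ω) ^ 2 ∂μ := by
        refine integral_congr_ae ?_
        filter_upwards [hcond] with ω hω
        simp [hω]
    _ = ∫ ω, (Var[f - g; μ | m]) ω ∂μ := by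
        have h := setIntegral_condVar (hm := hm) (s := Set.univ)
          (hfg.sub (hfg.condExp (m := m) one_le_two)).integrable_sq MeasurableSet.univ
        simpa using h.symm
    _ ≤ ∫ ω, (μ[(f - g) ^ 2 | m]) ω ∂μ :=
        integral_mono_ae integrable_condVar integrable_condExp (condVar_ae_le_condExp_sq hm hfg)
    _ = ∫ ω, (f ω - g ω) ^ 2 ∂μ := by
        rw [integral_condExp hm]
        simp

lemma gaussianReal_measureReal_Ici_le {t : ℝ} (ht : 0 ≤ t) :
    (gaussianReal 0 1).real (Set.Ici t) ≤ Real.exp (-(t ^ 2 / 2)) := by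
  have h := measure_ge_le_exp_mul_mgf (μ := gaussianReal 0 1) (X := id) t ht
    (integrable_exp_mul_gaussianReal t)
  rw [mgf_id_gaussianReal, ← Real.exp_add] at h
  refine h.trans_eq ?_
  congr 1
  simp
  ring

lemma gaussianReal_measureReal_Iic_neg_le {t : ℝ} (ht : 0 ≤ t) :
    (gaussianReal 0 1).real (Set.Iic (-t)) ≤ Real.exp (-(t ^ 2 / 2)) := by
  have h := measure_le_le_exp_mul_mgf (μ := gaussianReal 0 1) (X := id) (-t)
    (neg_nonpos.mpr ht) (integrable_exp_mul_gaussianReal (-t))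
  rw [mgf_id_gaussianReal, ← Real.exp_add] at h
  refine h.trans_eq ?_
  congr 1
  simp
  ring

lemma pi_gaussianReal_eval_preimage {ι : Type*} [Fintype ι] (i : ι) {s : Set ℝ}
    (hs : MeasurableSet s) :
    (Measure.pi fun _ : ι => gaussianReal 0 1) (Function.eval i ⁻¹' s) = gaussianReal 0 1 s :=
  (measurePreserving_eval (fun _ : ι => gaussianReal 0 1) i).measure_preimage hs.nullMeasurableSet

lemma isProbabilityMeasure_secMeasure {B : ℕ} (hB : B ≠ 0) :
    IsProbabilityMeasure (secMeasure B) := by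
  have : IsProbabilityMeasure ((B : ENNReal)⁻¹ • (Measure.count : Measure (Fin B))) := by
    constructor
    simp [Measure.count_univ, ENNReal.inv_mul_cancel (Nat.cast_ne_zero.mpr hB)
      (ENNReal.natCast_ne_top B)]
  unfold secMeasure
  infer_instance

lemma secMeasure_real_singleton_prod {B : ℕ} (b : Fin B) {s : Set ℝ} (hs : MeasurableSet s) :
    (secMeasure B).real ({b} ×ˢ (Function.eval b ⁻¹' s)) =
      (B : ℝ)⁻¹ * (gaussianReal 0 1).real s := by
  rw [measureReal_def, secMeasure, Measure.prod_prod, pi_gaussianReal_eval_preimage b hs]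
  simp [measureReal_def]

lemma secMeasure_real_univ_prod {B : ℕ} (hB : B ≠ 0) (b : Fin B) {s : Set ℝ}
    (hs : MeasurableSet s) :
    (secMeasure B).real (Set.univ ×ˢ (Function.eval b ⁻¹' s)) = (gaussianReal 0 1).real s := by
  rw [measureReal_def, secMeasure, Measure.prod_prod, pi_gaussianReal_eval_preimage b hs]
  simp [measureReal_def, Measure.count_univ, ENNReal.inv_mul_cancel (Nat.cast_ne_zero.mpr hB)
      (ENNReal.natCast_ne_top B)]

lemma measurable_secObs (B : ℕ) (ρ p : ℝ) : Measurable (secObs B ρ p) := by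
  refine measurable_pi_lambda _ fun b => ?_
  unfold secObs
  refine Measurable.add (Measurable.const_mul ?_ _) (by fun_prop)
  exact (measurable_of_countable fun j : Fin B => if j = b then (1 : ℝ) else 0).comp measurable_fst

lemma measurable_secSignal (B : ℕ) (p : ℝ) (b : Fin B) : Measurable (secSignal B p b) :=
  ((measurable_of_countable fun j : Fin B => if j = b then (1 : ℝ) else 0).comp
    measurable_fst).const_mul _

/-- Mean squared error of estimating one coordinate by thresholding the observation at `t`. -/
lemma integral_sq_sub_threshold_le {B : ℕ} (hB : B ≠ 0) (ρ p t : ℝ) (hp : 0 ≤ p) (b : Fin B) :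
    ∫ ω, (secSignal B p b ω - √p * (if t ≤ secObs B ρ p ω b then 1 else 0)) ^ 2 ∂secMeasure B ≤
      p * ((B : ℝ)⁻¹ * (gaussianReal 0 1).real (Set.Iic (t - √(ρ * p))) +
        (gaussianReal 0 1).real (Set.Ici t)) := by
  have := isProbabilityMeasure_secMeasure hB
  set E₁ : Set (Fin B × (Fin B → ℝ)) := {b} ×ˢ (Function.eval b ⁻¹' Set.Iic (t - √(ρ * p)))
  set E₂ : Set (Fin B × (Fin B → ℝ)) := Set.univ ×ˢ (Function.eval b ⁻¹' Set.Ici t)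
  have hE₁ : MeasurableSet E₁ :=
    (measurableSet_singleton b).prod (measurable_pi_apply b measurableSet_Iic)
  have hE₂ : MeasurableSet E₂ :=
    MeasurableSet.univ.prod (measurable_pi_apply b measurableSet_Ici)
  have hi₁ : Integrable (E₁.indicator (1 : Fin B × (Fin B → ℝ) → ℝ)) (secMeasure B) :=
    (integrable_const (1 : ℝ)).indicator hE₁
  have hi₂ : Integrable (E₂.indicator (1 : Fin B × (Fin B → ℝ) → ℝ)) (secMeasure B) :=
    (integrable_const (1 : ℝ)).indicator hE₂
  calc _ ≤ ∫ ω, p * (E₁.indicator 1 ω + E₂.indicator 1 ω) ∂secMeasure B := by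
        refine integral_mono_of_nonneg (ae_of_all _ fun ω => sq_nonneg _)
          ((hi₁.add hi₂).const_mul p) (ae_of_all _ fun ω => ?_)
        simp only [secSignal, secObs, ← mul_sub, mul_pow, Real.sq_sqrt hp]
        refine mul_le_mul_of_nonneg_left ?_ hp
        have h₁ : 0 ≤ E₁.indicator (1 : Fin B × (Fin B → ℝ) → ℝ) ω :=
          Set.indicator_nonneg (fun _ _ => zero_le_one) _
        have h₂ : 0 ≤ E₂.indicator (1 : Fin B × (Fin B → ℝ) → ℝ) ω :=
          Set.indicator_nonneg (fun _ _ => zero_le_one) _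
        by_cases hb : ω.1 = b
        · by_cases ht : t ≤ √(ρ * p) + ω.2 b
          · simp only [hb, if_true, mul_one, ht]
            linarith
          · have hmem : ω ∈ E₁ := ⟨hb, by
              simp only [Set.mem_preimage, Function.eval, Set.mem_Iic]; linarith⟩
            simp only [hb, if_true, mul_one, ht, Set.indicator_of_mem hmem, if_false]
            norm_num
            exact h₂
        · by_cases ht : t ≤ ω.2 b
          · have hmem : ω ∈ E₂ := ⟨trivial, ht⟩
            simp only [hb, if_false, mul_zero, zero_add, ht, if_true, Set.indicator_of_mem hmem]
            norm_num
            exact h₁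
          · simp only [hb, if_false, mul_zero, zero_add, ht]
            linarith
    _ = p * ((secMeasure B).real E₁ + (secMeasure B).real E₂) := by
        rw [integral_const_mul, integral_add hi₁ hi₂, integral_indicator_one hE₁,
          integral_indicator_one hE₂]
    _ = _ := by
        rw [secMeasure_real_singleton_prod b measurableSet_Iic,
          secMeasure_real_univ_prod hB b measurableSet_Ici]

/-- Non-asymptotic bound on the section MMSE by the error of a threshold estimator. -/
lemma secMMSE_le {B : ℕ} (hB : B ≠ 0) {ρ p t : ℝ} (hp : 0 ≤ p) (ht : 0 ≤ t)
    (hts : t ≤ √(ρ * p)) :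
    secMMSE B ρ p ≤
      p * (Real.exp (-((√(ρ * p) - t) ^ 2 / 2)) + B * Real.exp (-(t ^ 2 / 2))) := by
  have := isProbabilityMeasure_secMeasure hB
  have hB' : (B : ℝ) ≠ 0 := Nat.cast_ne_zero.mpr hB
  have hindicator : ∀ q : Prop, ∀ [Decidable q], ‖√p * (if q then (1 : ℝ) else 0)‖ ≤ √p := by
    intro q _
    split_ifs <;> simp [abs_of_nonneg (Real.sqrt_nonneg p)]
  have key : ∀ b : Fin B, ∫ ω, (secSignal B p b ω -
      ((secMeasure B)[secSignal B p b |
        MeasurableSpace.comap (secObs B ρ p) inferInstance]) ω) ^ 2 ∂(secMeasure B) ≤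
      p * ((B : ℝ)⁻¹ * Real.exp (-((√(ρ * p) - t) ^ 2 / 2)) + Real.exp (-(t ^ 2 / 2))) := by
    intro b
    have hm := (measurable_secObs B ρ p).comap_le
    have hthr : Measurable fun y : Fin B → ℝ => √p * (if t ≤ y b then (1 : ℝ) else 0) :=
      (Measurable.ite (measurableSet_le measurable_const (measurable_pi_apply b))
        measurable_const measurable_const).const_mul _
    have hgm : Measurable[MeasurableSpace.comap (secObs B ρ p) inferInstance]
        fun ω => √p * (if t ≤ secObs B ρ p ω b then (1 : ℝ) else 0) :=
      hthr.comp (comap_measurable _)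
    refine (integral_sq_sub_condExp_le hm
      (MemLp.of_bound (measurable_secSignal B p b).aestronglyMeasurable (√p)
        (ae_of_all _ fun ω => hindicator _))
      (MemLp.of_bound (hgm.mono hm le_rfl).aestronglyMeasurable (√p)
        (ae_of_all _ fun ω => hindicator _)) hgm.stronglyMeasurable).trans ?_
    refine (integral_sq_sub_threshold_le hB ρ p t hp b).trans ?_
    have h₁ := gaussianReal_measureReal_Iic_neg_le (sub_nonneg.mpr hts)
    rw [neg_sub] at h₁
    have h₂ := gaussianReal_measureReal_Ici_le ht
    gcongr
  refine (Finset.sum_le_sum fun b _ => key b).trans_eq ?_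
  simp only [Finset.sum_const, Finset.card_univ, Fintype.card_fin, nsmul_eq_mul]
  field_simp

lemma secMMSE_nonneg (B : ℕ) (ρ p : ℝ) : 0 ≤ secMMSE B ρ p :=
  Finset.sum_nonneg fun _ _ => integral_nonneg fun _ => sq_nonneg _

/-- When `ρp ≥ 2a log B` with `a > c > 0`, thresholding at `√(2c log B)` bounds the normalized
section MMSE by two negative powers of `B`. -/
lemma secMMSE_div_le {B : ℕ} (hB : 2 ≤ B) {ρ p a c : ℝ} (hp : 0 < p) (hc : 0 < c) (hca : c < a)
    (ha : a ≤ ρ * p / (2 * Real.log B)) :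
    secMMSE B ρ p / p ≤
      Real.exp (-((√a - √c) ^ 2 * Real.log B)) + Real.exp (-((c - 1) * Real.log B)) := by
  have hB0 : (0 : ℝ) < B := by positivity
  have hL : 0 < Real.log B := Real.log_pos (by exact_mod_cast hB)
  set L := Real.log B with hLdef
  have hs : √a * √(2 * L) ≤ √(ρ * p) := by
    rw [← Real.sqrt_mul (hc.trans hca).le]
    exact Real.sqrt_le_sqrt ((le_div_iff₀ (by positivity)).mp ha)
  have hac : √c ≤ √a := Real.sqrt_le_sqrt hca.le
  have hsq : √(2 * L) ^ 2 = 2 * L := Real.sq_sqrt (by positivity)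
  have hts : √c * √(2 * L) ≤ √a * √(2 * L) := by gcongr
  have hbound := secMMSE_le (by omega : B ≠ 0) hp.le
    (by positivity : 0 ≤ √c * √(2 * L)) (hts.trans hs)
  rw [div_le_iff₀' hp]
  refine hbound.trans (mul_le_mul_of_nonneg_left (add_le_add ?_ (le_of_eq ?_)) hp.le)
  · refine Real.exp_le_exp.mpr (neg_le_neg ?_)
    have hgap : (√a - √c) * √(2 * L) ≤ √(ρ * p) - √c * √(2 * L) := by linarith
    have hpow := pow_le_pow_left₀ (mul_nonneg (sub_nonneg.mpr hac) (Real.sqrt_nonneg _)) hgap 2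
    rw [mul_pow, hsq] at hpow
    linarith
  · rw [mul_pow, hsq, Real.sq_sqrt hc.le]
    nth_rewrite 1 [← Real.exp_log hB0]
    rw [← Real.exp_add]
    congr 1
    rw [← hLdef]
    ring

/-- supercritical phase of the section MMSE phase transition:
if `liminf ρₙpₙ/(2 log Bₙ) > 1` then `mmse(Bₙ,ρₙ,pₙ)/pₙ → 0`. -/
theorem secMMSE_tendsto_zero_of_supercritical
    (Bseq : ℕ → ℕ) (ρseq pseq : ℕ → ℝ)
    (hB2 : ∀ n, 2 ≤ Bseq n)
    (hBtop : Filter.Tendsto Bseq Filter.atTop Filter.atTop)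
    (hρ : ∀ n, 0 < ρseq n) (hp : ∀ n, 0 < pseq n)
    (hcrit : 1 < Filter.liminf
      (fun n => ρseq n * pseq n / (2 * Real.log (Bseq n))) Filter.atTop) :
    Filter.Tendsto (fun n => secMMSE (Bseq n) (ρseq n) (pseq n) / pseq n)
      Filter.atTop (nhds 0) := by
  rw [Filter.liminf_eq] at hcrit
  have hne : {x : ℝ | ∀ᶠ n in Filter.atTop,
      x ≤ ρseq n * pseq n / (2 * Real.log (Bseq n))}.Nonempty := by
    by_contra h
    rw [Set.not_nonempty_iff_eq_empty.mp h, Real.sSup_empty] at hcrit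
    linarith
  obtain ⟨a, ha, ha1⟩ := exists_lt_of_lt_csSup hne hcrit
  obtain ⟨c, hc1, hca⟩ := exists_between ha1
  have hc0 : 0 < c := zero_lt_one.trans hc1
  have hlog : Filter.Tendsto (fun n => Real.log (Bseq n)) Filter.atTop Filter.atTop :=
    Real.tendsto_log_atTop.comp (tendsto_natCast_atTop_atTop.comp hBtop)
  have hexp : ∀ k : ℝ, 0 < k → Filter.Tendsto
      (fun n => Real.exp (-(k * Real.log (Bseq n)))) Filter.atTop (nhds 0) := fun k hk =>
    Real.tendsto_exp_neg_atTop_nhds_zero.comp (hlog.const_mul_atTop hk)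
  have hgap : 0 < (√a - √c) ^ 2 :=
    pow_pos (sub_pos.mpr (Real.sqrt_lt_sqrt hc0.le hca)) 2
  have hlim := (hexp _ hgap).add (hexp _ (sub_pos.mpr hc1))
  rw [add_zero] at hlim
  refine tendsto_of_tendsto_of_tendsto_of_le_of_le' tendsto_const_nhds hlim
    (Filter.Eventually.of_forall fun n => div_nonneg (secMMSE_nonneg _ _ _) (hp n).le) ?_
  filter_upwards [ha] with n hn
  exact secMMSE_div_le (hB2 n) (hp n) hc0 hca hn
end
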